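/- arXiv:1502.01875 — 2 statements merged into one kernel-verified Lean document; each statement's English description precedes it below -/
import Mathlib

section
/- The value of the canonical extension at a point χ_A with |A| = m+1 is T(f)(χ_A) = ∑_{B ⊊ A} (-1)^{m-|B|} f(χ_B), and hence the operator norm of the canonical extension operator from C(σ_m(2^X)) to C(σ_{m+1}(2^X)), for |X| ≥ m+1, equals 2^{m+1} - 1, i.e., ∑_{k=0}^{m} C(m+1, k) = 2^{m+1} - 1. -/
/-- The characteristic function of a finite set, as an element of `{0,1}^X`. -/
def chi {X : Type*} [DecidableEq X] (A : Finset X) : X → Bool := fun x => decide (x ∈ A)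

/-- `σ_n(2^X) = {χ_A : A ⊆ X, |A| ≤ n} ⊆ {0,1}^X`, with the product topology. -/
def sigmaSet (X : Type*) [DecidableEq X] (n : ℕ) : Set (X → Bool) :=
  {f | ∃ A : Finset X, A.card ≤ n ∧ f = chi A}

/-- The point `χ_A ∈ σ_n(2^X)` associated to a finite set `A` with `|A| ≤ n`. -/
def mkPt {X : Type*} [DecidableEq X] {n : ℕ} (A : Finset X) (h : A.card ≤ n) :
    sigmaSet X n := ⟨chi A, A, h, rfl⟩

open Finset in
theorem filter_card_le_powerset_eq {X : Type*} [DecidableEq X] {m : ℕ} {A : Finset X}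
    (hA : A.card = m + 1) :
    A.powerset.filter (fun B => B.card ≤ m) = A.powerset.filter (fun B => B ≠ A) := by
  refine filter_congr fun B hB => ?_
  have hBA := mem_powerset.1 hB
  constructor
  · rintro h rfl
    omega
  · intro h
    have := card_lt_card (hBA.ssubset_of_ne h)
    omega

open Finset in
theorem card_filter_ne_powerset {X : Type*} [DecidableEq X] (A : Finset X) :
    (A.powerset.filter (fun B => B ≠ A)).card = 2 ^ A.card - 1 := by
  rw [filter_ne', card_erase_of_mem (mem_powerset_self A), card_powerset]

theorem sum_range_choose_succ_eq (m : ℕ) :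
    ∑ k ∈ Finset.range (m + 1), (m + 1).choose k = 2 ^ (m + 1) - 1 := by
  have h := Nat.sum_range_choose (m + 1)
  rw [Finset.sum_range_succ, Nat.choose_self] at h
  omega

/-- The function `χ_B ↦ (-1)^{|A ∩ B|}` on `σ_n(2^X)`. -/
noncomputable def paritySign {X : Type*} [DecidableEq X] (n : ℕ) (A : Finset X) :
    BoundedContinuousFunction (sigmaSet X n) ℝ :=
  BoundedContinuousFunction.ofNormedAddCommGroup
    (fun x => ∏ a ∈ A, if x.1 a then (-1 : ℝ) else 1)
    (continuous_finsetProd A fun a _ =>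
      (continuous_of_discreteTopology (f := fun b : Bool => if b then (-1 : ℝ) else 1)).comp
        ((continuous_apply a).comp continuous_subtype_val))
    1 (fun x => by
      rw [norm_prod]
      refine Finset.prod_le_one (fun _ _ => norm_nonneg _) fun a _ => ?_
      split_ifs <;> simp)

theorem norm_paritySign_le {X : Type*} [DecidableEq X] (n : ℕ) (A : Finset X) :
    ‖paritySign n A‖ ≤ 1 :=
  BoundedContinuousFunction.norm_ofNormedAddCommGroup_le _ zero_le_one _

theorem paritySign_mkPt {X : Type*} [DecidableEq X] {n : ℕ} {A B : Finset X}
    (hBA : B ⊆ A) (hB : B.card ≤ n) :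
    paritySign n A (mkPt B hB) = (-1) ^ B.card := by
  change ∏ a ∈ A, (if decide (a ∈ B) then (-1 : ℝ) else 1) = _
  simp only [decide_eq_true_eq]
  rw [Finset.prod_ite_mem, Finset.inter_eq_right.2 hBA, Finset.prod_const]

/-- For `n = m + 1` and `|X| ≥ m + 1`, the canonical extension operator
`T : C(σ_m(2^X)) → C(σ_{m+1}(2^X))` satisfies `T f (χ_A) = ∑_{B ⊊ A} (-1)^{m-|B|} f(χ_B)`
for `|A| = m + 1`, its operator norm is `2^{m+1} - 1`, and
`∑_{k=0}^{m} C(m+1,k) = 2^{m+1} - 1`. -/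
theorem canonical_extension_succ {X : Type*} [DecidableEq X] (m : ℕ)
    (hX : ((m + 1 : ℕ) : Cardinal) ≤ Cardinal.mk X)
    (T : BoundedContinuousFunction (sigmaSet X m) ℝ →L[ℝ]
          BoundedContinuousFunction (sigmaSet X (m + 1)) ℝ)
    (hext : ∀ (f : BoundedContinuousFunction (sigmaSet X m) ℝ) (A : Finset X)
      (hA : A.card ≤ m), T f (mkPt A (hA.trans (Nat.le_succ m))) = f (mkPt A hA))
    (hform : ∀ (f : BoundedContinuousFunction (sigmaSet X m) ℝ) (A : Finset X)
      (hA : A.card ≤ m + 1), m < A.card →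
        T f (mkPt A hA) = ∑ B ∈ A.powerset.filter (fun B => B.card ≤ m),
          (-1 : ℝ) ^ (m - B.card) * ((A.card - B.card - 1).choose (m - B.card)) *
            (if h : B.card ≤ m then f (mkPt B h) else 0)) :
    (∀ (f : BoundedContinuousFunction (sigmaSet X m) ℝ) (A : Finset X)
      (hA : A.card = m + 1),
        T f (mkPt A hA.le) = ∑ B ∈ A.powerset.filter (fun B => B ≠ A),
          (-1 : ℝ) ^ (m - B.card) *
            (if h : B.card ≤ m then f (mkPt B h) else 0)) ∧
    ‖T‖ = 2 ^ (m + 1) - 1 ∧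
    ∑ k ∈ Finset.range (m + 1), (m + 1).choose k = 2 ^ (m + 1) - 1 := by
  have hval : ∀ (f : BoundedContinuousFunction (sigmaSet X m) ℝ) (A : Finset X)
      (hA : A.card = m + 1),
        T f (mkPt A hA.le) = ∑ B ∈ A.powerset.filter (fun B => B ≠ A),
          (-1 : ℝ) ^ (m - B.card) *
            (if h : B.card ≤ m then f (mkPt B h) else 0) := by
    intro f A hA
    rw [hform f A hA.le (by omega), ← filter_card_le_powerset_eq hA]
    refine Finset.sum_congr rfl fun B hB => ?_
    have hBm := (Finset.mem_filter.1 hB).2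
    rw [show A.card - B.card - 1 = m - B.card by omega, Nat.choose_self, Nat.cast_one, mul_one]
  have hcard : ∀ A : Finset X, A.card = m + 1 →
      ((A.powerset.filter (fun B => B ≠ A)).card : ℝ) = 2 ^ (m + 1) - 1 := by
    intro A hA
    rw [card_filter_ne_powerset, hA, Nat.cast_sub Nat.one_le_two_pow]
    norm_num
  have hpow : (1 : ℝ) ≤ 2 ^ (m + 1) - 1 := by
    have : (1 : ℝ) ≤ 2 ^ m := one_le_pow₀ one_le_two
    rw [pow_succ]
    linarith
  refine ⟨hval, le_antisymm ?_ ?_, sum_range_choose_succ_eq m⟩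
  · refine T.opNorm_le_bound (by linarith) fun f => ?_
    refine (BoundedContinuousFunction.norm_le (by positivity)).2 ?_
    rintro ⟨_, A, hA, rfl⟩
    change ‖T f (mkPt A hA)‖ ≤ _
    rcases Nat.le_or_eq_of_le_succ hA with h | h
    · rw [hext f A h]
      exact (f.norm_coe_le_norm _).trans (le_mul_of_one_le_left (norm_nonneg _) hpow)
    · rw [hval f A h, ← hcard A h, ← nsmul_eq_mul]
      refine (norm_sum_le _ _).trans (Finset.sum_le_card_nsmul _ _ _ fun B _ => ?_)
      rw [norm_mul, norm_pow, norm_neg, norm_one, one_pow, one_mul]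
      split_ifs
      · exact f.norm_coe_le_norm _
      · simp
  · obtain ⟨s, hs⟩ := Cardinal.le_mk_iff_exists_set.1 hX
    have hfin : s.Finite := Cardinal.lt_aleph0_iff_set_finite.1 (hs ▸ Cardinal.natCast_lt_aleph0)
    obtain ⟨A, rfl⟩ := hfin.exists_finset_coe
    have hA : A.card = m + 1 :=
      Nat.cast_injective (Cardinal.mk_coe_finset.symm.trans hs)
    have hsum : T (paritySign m A) (mkPt A hA.le) = (-1) ^ m * (2 ^ (m + 1) - 1) := by
      rw [hval _ A hA, ← hcard A hA, mul_comm, ← nsmul_eq_mul]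
      refine Finset.sum_eq_card_nsmul fun B hB => ?_
      rw [← filter_card_le_powerset_eq hA, Finset.mem_filter, Finset.mem_powerset] at hB
      rw [dif_pos hB.2, paritySign_mkPt hB.1, ← pow_add, Nat.sub_add_cancel hB.2]
    calc (2 : ℝ) ^ (m + 1) - 1 = ‖T (paritySign m A) (mkPt A hA.le)‖ := by
          rw [hsum, norm_mul, norm_pow, norm_neg, norm_one, one_pow, one_mul,
            Real.norm_of_nonneg (by linarith)]
      _ ≤ ‖T (paritySign m A)‖ := BoundedContinuousFunction.norm_coe_le_norm _ _
      _ ≤ ‖T‖ * 1 := T.le_opNorm_of_le (norm_paritySign_le m A)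
      _ = ‖T‖ := mul_one _
end

section
/- Let H be a nonseparable Hilbert space and B_H its closed unit ball with the weak topology. Then for any 0 < λ < μ ≤ 1, there is no extension operator T : C(λB_H) → C(μB_H), i.e., no bounded linear operator with T(f)|_{λB_H} = f for all f ∈ C(λB_H). -/
open Filter Topology Set

/-- Free sets for finite set mappings: if `F` assigns a finite set to each point, then every
uncountable set contains arbitrarily long finite sequences that are free for `F`. -/
theorem Set.exists_free_tuple_of_not_countable {ι : Type*} (F : ι → Set ι)
    (hF : ∀ a, (F a).Finite) (n : ℕ) {X : Set ι} (hX : ¬ X.Countable) :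
    ∃ a : Fin n → ι, (∀ i, a i ∈ X) ∧ ∀ i j, i ≠ j → a i ∉ F (a j) := by
  induction n generalizing X with
  | zero => exact ⟨Fin.elim0, fun i => i.elim0, fun i => i.elim0⟩
  | succ n ih =>
    have hinf : X.Infinite := fun h => hX h.countable
    let d : ℕ → ι := fun m => hinf.natEmbedding X m
    have hdX : ∀ m, d m ∈ X := fun m => (hinf.natEmbedding X m).2
    have hd : Function.Injective d :=
      Subtype.val_injective.comp (hinf.natEmbedding X).injective
    obtain ⟨m, hm⟩ : ∃ m, ¬ {x ∈ X | d m ∉ F x ∧ x ∉ F (d m)}.Countable := by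
      by_contra! h
      refine hX (((countable_iUnion fun m => (hF (d m)).countable).union
        (countable_iUnion h)).mono fun x hx => ?_)
      by_cases hxF : ∃ m, x ∈ F (d m)
      · exact Or.inl (mem_iUnion.2 hxF)
      · push Not at hxF
        obtain ⟨m, hm⟩ : ∃ m, m ∉ d ⁻¹' F x :=
          ((hF x).preimage hd.injOn).exists_notMem
        exact Or.inr (mem_iUnion.2 ⟨m, hx, hm, hxF m⟩)
    obtain ⟨a, haX, ha⟩ := ih hm
    refine ⟨Fin.cons (d m) a, fun i => ?_, fun i j => ?_⟩
    · cases i using Fin.cases with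
      | zero => exact hdX m
      | succ i => exact (haX i).1
    · cases i using Fin.cases with
      | zero =>
        cases j using Fin.cases with
        | zero => exact fun h => (h rfl).elim
        | succ j => exact fun _ => (haX j).2.1
      | succ i =>
        cases j using Fin.cases with
        | zero => exact fun _ => (haX i).2.2
        | succ j => exact fun h => ha i j fun hij => h (congrArg Fin.succ hij)

theorem Finset.sum_le_one_of_pairwise_eq_zero {ι : Type*} (s : Finset ι) (g : ι → ℝ)
    (hg : ∀ i, g i ≤ 1) (h : ∀ i j, i ≠ j → g i = 0 ∨ g j = 0) : ∑ i ∈ s, g i ≤ 1 := by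
  by_cases hs : ∃ i ∈ s, g i ≠ 0
  · obtain ⟨i, hi, hi0⟩ := hs
    rw [Finset.sum_eq_single_of_mem i hi fun j _ hji => (h j i hji).resolve_right hi0]
    exact hg i
  · push Not at hs
    rw [Finset.sum_eq_zero hs]
    exact zero_le_one

section InnerProductSpace

variable {H : Type*} [NormedAddCommGroup H] [InnerProductSpace ℝ H]

theorem exists_orthonormal_not_countable [CompleteSpace H]
    (hH : ¬ TopologicalSpace.SeparableSpace H) :
    ∃ w : Set H, Orthonormal ℝ (Subtype.val : w → H) ∧ ¬ w.Countable := by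
  obtain ⟨w, b, hb⟩ := exists_hilbertBasis ℝ H
  refine ⟨w, hb ▸ b.orthonormal, fun hw => hH ?_⟩
  have hsep := (hw.isSeparable.span (R := ℝ)).closure
  have hspan := b.dense_span
  rw [hb, Subtype.range_coe] at hspan
  rw [← Submodule.topologicalClosure_coe, hspan, Submodule.top_coe] at hsep
  exact TopologicalSpace.isSeparable_univ_iff.1 hsep

theorem Orthonormal.tendsto_toWeakSpace_cofinite [CompleteSpace H] {ι : Type*} {e : ι → H}
    (he : Orthonormal ℝ e) : Tendsto (fun i => toWeakSpace ℝ H (e i)) cofinite (𝓝 0) := by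
  have hinj : Function.Injective (topDualPairing ℝ H).flip := fun x y hxy =>
    ext_inner_left ℝ fun v => LinearMap.congr_fun hxy (innerSL ℝ v)
  refine (WeakBilin.tendsto_iff_forall_eval_tendsto (topDualPairing ℝ H).flip hinj).2 fun f => ?_
  have hroot := (he.inner_products_summable
    ((InnerProductSpace.toDual ℝ H).symm f)).tendsto_cofinite_zero.sqrt
  simp only [Real.sqrt_sq (norm_nonneg _), Real.sqrt_zero] at hroot
  have hlim := tendsto_zero_iff_norm_tendsto_zero.2 hroot
  refine (hlim.congr fun i => ?_).trans (le_of_eq ?_)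
  · rw [real_inner_comm]
    exact InnerProductSpace.toDual_symm_apply
  · exact congrArg 𝓝 (map_zero f).symm

theorem WeakSpace.continuous_inner_symm (v : H) :
    Continuous fun x : WeakSpace ℝ H => inner ℝ v ((toWeakSpace ℝ H).symm x) :=
  WeakBilin.eval_continuous (topDualPairing ℝ H).flip (innerSL ℝ v)

/-- A weakly continuous bump function on a ball, peaking at a given point `v` of its sphere. -/
theorem exists_weak_bump {lam r : ℝ} (hr : r < lam ^ 2) {v : H} (hv : ‖v‖ = lam) :
    ∃ f : BoundedContinuousFunction
        ((toWeakSpace ℝ H) '' Metric.closedBall 0 lam : Set (WeakSpace ℝ H)) ℝ,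
      (∀ x, 0 ≤ f x) ∧ (∀ x, f x ≤ 1) ∧
      (∀ x, r < inner ℝ v ((toWeakSpace ℝ H).symm x.1) ∨ f x = 0) ∧
      ∀ h, f ⟨toWeakSpace ℝ H v, h⟩ = 1 := by
  have hpos : 0 < lam ^ 2 - r := sub_pos.2 hr
  let g : WeakSpace ℝ H → ℝ := fun x =>
    max 0 ((inner ℝ v ((toWeakSpace ℝ H).symm x) - r) / (lam ^ 2 - r))
  have hg : Continuous g :=
    continuous_const.max (((WeakSpace.continuous_inner_symm v).sub continuous_const).div_const _)
  have hg0 : ∀ x, 0 ≤ g x := fun x => le_max_left _ _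
  have hg1 : ∀ x ∈ (toWeakSpace ℝ H) '' Metric.closedBall 0 lam, g x ≤ 1 := by
    rintro _ ⟨x, hx, rfl⟩
    refine max_le zero_le_one ((div_le_one hpos).2 (sub_le_sub_right ?_ r))
    have hx' : ‖x‖ ≤ lam := by simpa using hx
    calc inner ℝ v x ≤ ‖v‖ * ‖x‖ := real_inner_le_norm v x
      _ ≤ lam * lam := by rw [hv]; gcongr; exact hv ▸ norm_nonneg v
      _ = lam ^ 2 := by ring
  refine ⟨BoundedContinuousFunction.ofNormedAddCommGroup (fun x => g x)
    (hg.comp continuous_subtype_val) 1 fun x => ?_, fun x => hg0 x, fun x => hg1 x x.2,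
    fun x => ?_, fun h => ?_⟩
  · rw [Real.norm_of_nonneg (hg0 x)]
    exact hg1 x x.2
  · by_cases hx : r < inner ℝ v ((toWeakSpace ℝ H).symm x.1)
    · exact Or.inl hx
    · exact Or.inr (max_eq_left (div_nonpos_of_nonpos_of_nonneg
        (sub_nonpos.2 (not_lt.1 hx)) hpos.le))
  · change max 0 ((inner ℝ v v - r) / (lam ^ 2 - r)) = 1
    rw [real_inner_self_eq_norm_sq, hv, div_self hpos.ne', max_eq_right zero_le_one]

theorem Orthonormal.norm_smul_add_smul_sum_sq {ι : Type*} {e : ι → H} (he : Orthonormal ℝ e)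
    (t c : ℝ) {o : ι} {n : ℕ} {a : Fin n → ι} (ha : Function.Injective a) (ho : ∀ i, a i ≠ o) :
    ‖t • e o + c • ∑ i, e (a i)‖ ^ 2 = t ^ 2 + n * c ^ 2 := by
  classical
  have hsum : ‖∑ i, e (a i)‖ ^ 2 = n := by
    rw [← real_inner_self_eq_norm_sq]
    simp_rw [sum_inner, inner_sum, orthonormal_iff_ite.1 he]
    simp [ha.eq_iff]
  have horth : inner ℝ (t • e o) (c • ∑ i, e (a i)) = 0 := by
    simp [inner_smul_left, inner_smul_right, inner_sum, orthonormal_iff_ite.1 he,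
      fun i => (ho i).symm]
  rw [norm_add_sq_real, horth, norm_smul, norm_smul, mul_pow, mul_pow, hsum, he.1 o]
  simp
  ring

end InnerProductSpace


/-- Let `H` be a nonseparable (real) Hilbert space and `B_H` its closed unit ball with the
weak topology. Then for any `0 < λ < μ ≤ 1` there is no extension operator
`T : C(λ B_H) → C(μ B_H)`, i.e., no bounded linear operator with `T(f)|_{λ B_H} = f`
for all `f ∈ C(λ B_H)`. -/
theorem no_extension_operator_on_balls {H : Type*} [NormedAddCommGroup H]
    [InnerProductSpace ℝ H] [CompleteSpace H]
    (hH : ¬ TopologicalSpace.SeparableSpace H)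
    (lam mu : ℝ) (h0 : 0 < lam) (h1 : lam < mu) (h2 : mu ≤ 1) :
    ¬ ∃ T : BoundedContinuousFunction
            ((toWeakSpace ℝ H) '' Metric.closedBall 0 lam : Set (WeakSpace ℝ H)) ℝ →L[ℝ]
          BoundedContinuousFunction
            ((toWeakSpace ℝ H) '' Metric.closedBall 0 mu : Set (WeakSpace ℝ H)) ℝ,
      ∀ (f : BoundedContinuousFunction
            ((toWeakSpace ℝ H) '' Metric.closedBall 0 lam : Set (WeakSpace ℝ H)) ℝ)
        (x : ((toWeakSpace ℝ H) '' Metric.closedBall 0 mu : Set (WeakSpace ℝ H)))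
        (hx : (x : WeakSpace ℝ H) ∈ (toWeakSpace ℝ H) '' Metric.closedBall 0 lam),
        T f x = f ⟨x, hx⟩ := by
  rintro ⟨T, hT⟩
  obtain ⟨w, he, hw⟩ := exists_orthonormal_not_countable hH
  set e : w → H := Subtype.val
  have hX : ¬ (univ : Set w).Countable := fun h => hw (countable_univ_iff.1 h)
  obtain ⟨o⟩ : Nonempty w := by
    by_contra h
    rw [not_nonempty_iff] at h
    exact hX (Set.to_countable _)
  have hXo : ¬ ({o}ᶜ : Set w).Countable := fun h => hX <| by
    simpa using (countable_singleton o).union h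
  obtain ⟨n, hn⟩ := exists_nat_gt (2 * ‖T‖)
  have hgap : 0 < mu ^ 2 - lam ^ 2 := by nlinarith
  obtain ⟨c, t, hc, htc, hck⟩ : ∃ c t : ℝ, 0 < c ∧ t ^ 2 + c ^ 2 = lam ^ 2 ∧
      n * c ^ 2 ≤ mu ^ 2 - lam ^ 2 := by
    have hq : 0 < min (lam ^ 2) ((mu ^ 2 - lam ^ 2) / (n + 1)) := by positivity
    refine ⟨√(min (lam ^ 2) ((mu ^ 2 - lam ^ 2) / (n + 1))),
      √(lam ^ 2 - min (lam ^ 2) ((mu ^ 2 - lam ^ 2) / (n + 1))), Real.sqrt_pos.2 hq, ?_, ?_⟩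
    · rw [Real.sq_sqrt hq.le, Real.sq_sqrt (sub_nonneg.2 (min_le_left _ _))]
      ring
    · rw [Real.sq_sqrt hq.le]
      calc n * min (lam ^ 2) ((mu ^ 2 - lam ^ 2) / (n + 1))
          ≤ (n + 1) * ((mu ^ 2 - lam ^ 2) / (n + 1)) := by
            gcongr
            · linarith
            · exact min_le_right _ _
        _ = mu ^ 2 - lam ^ 2 := by field_simp
  let p : w → H := fun a => t • e o + c • e a
  have hp : ∀ a, a ≠ o → ‖p a‖ = lam := fun a ha => by
    have := he.norm_smul_add_smul_sum_sq t c (a := fun _ : Fin 1 => a)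
      (Function.injective_of_subsingleton _) (fun _ => ha)
    simp only [Finset.univ_unique, Finset.sum_const, Finset.card_singleton, one_smul,
      Nat.cast_one, one_mul, htc] at this
    exact (sq_eq_sq₀ (norm_nonneg _) h0.le).1 this
  set r : ℝ := lam * √(lam ^ 2 - c ^ 2 / 2)
  have hs : √(lam ^ 2 - c ^ 2 / 2) < lam := by
    rw [Real.sqrt_lt' h0]
    have := pow_pos hc 2
    linarith
  have hr : r < lam ^ 2 := by
    rw [sq]
    exact mul_lt_mul_of_pos_left hs h0
  have hpair : ∀ a b, a ≠ o → b ≠ o → a ≠ b → ‖p a + p b‖ = 2 * √(lam ^ 2 - c ^ 2 / 2) := by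
    intro a b ha hb hab
    have := he.norm_smul_add_smul_sum_sq (2 * t) c (o := o) (a := ![a, b])
      (injective_pair_iff_ne.2 hab) (Fin.forall_fin_two.2 ⟨ha, hb⟩)
    have hsum : p a + p b = (2 * t) • e o + c • ∑ i, e (![a, b] i) := by
      simp only [p, Fin.sum_univ_two, Matrix.cons_val_zero, Matrix.cons_val_one]
      module
    have hnn : 0 ≤ lam ^ 2 - c ^ 2 / 2 := by nlinarith [sq_nonneg t, sq_nonneg c]
    rw [← sq_eq_sq₀ (norm_nonneg _) (by positivity), hsum, this, mul_pow, mul_pow,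
      Real.sq_sqrt hnn, ← htc]
    push_cast
    ring
  have hbump : ∀ a : w, ∃ f : BoundedContinuousFunction
      ((toWeakSpace ℝ H) '' Metric.closedBall 0 lam : Set (WeakSpace ℝ H)) ℝ, a ≠ o →
      (∀ x, 0 ≤ f x) ∧ (∀ x, f x ≤ 1) ∧
      (∀ x, r < inner ℝ (p a) ((toWeakSpace ℝ H).symm x.1) ∨ f x = 0) ∧
      ∀ h, f ⟨toWeakSpace ℝ H (p a), h⟩ = 1 := fun a => by
    by_cases ha : a = o
    · exact ⟨0, fun h => (h ha).elim⟩
    · obtain ⟨f, hf⟩ := exists_weak_bump hr (hp a ha)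
      exact ⟨f, fun _ => hf⟩
  choose f hf using hbump
  have hdisj : ∀ a b, a ≠ o → b ≠ o → a ≠ b → ∀ x, f a x = 0 ∨ f b x = 0 := by
    intro a b ha hb hab x
    by_contra! h
    have h₁ := ((hf a ha).2.2.1 x).resolve_right h.1
    have h₂ := ((hf b hb).2.2.1 x).resolve_right h.2
    obtain ⟨_, y, hy, rfl⟩ := x
    have hy' : ‖y‖ ≤ lam := by simpa using hy
    simp only [LinearEquiv.symm_apply_apply] at h₁ h₂
    have hle := real_inner_le_norm (p a + p b) y
    rw [hpair a b ha hb hab, inner_add_left] at hle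
    have : 2 * √(lam ^ 2 - c ^ 2 / 2) * ‖y‖ ≤ 2 * √(lam ^ 2 - c ^ 2 / 2) * lam := by gcongr
    simp only [r] at h₁ h₂
    linarith
  have hloc : ∀ a : w, ∃ F : Set w, F.Finite ∧ (a ≠ o → ∀ b : Fin n → w, (∀ i, b i ∉ F) →
      ∀ h, 1 / 2 < T (f a) ⟨toWeakSpace ℝ H (p a + c • ∑ i, e (b i)), h⟩) := by
    intro a
    by_cases ha : a = o
    · exact ⟨∅, finite_empty, fun h => (h ha).elim⟩
    have hpl : toWeakSpace ℝ H (p a) ∈ (toWeakSpace ℝ H) '' Metric.closedBall 0 lam :=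
      ⟨p a, by simp [hp a ha], rfl⟩
    have hpm : toWeakSpace ℝ H (p a) ∈ (toWeakSpace ℝ H) '' Metric.closedBall 0 mu :=
      ⟨p a, by simp [hp a ha, h1.le], rfl⟩
    obtain ⟨U, hU, hUeq⟩ := isOpen_induced_iff.1
      (isOpen_lt (continuous_const (y := (1 / 2 : ℝ))) (T (f a)).continuous)
    have hmem : ∀ x, x.1 ∈ U ↔ 1 / 2 < T (f a) x := fun x => Set.ext_iff.1 hUeq x
    have hpU : toWeakSpace ℝ H (p a) ∈ U := by
      refine (hmem ⟨_, hpm⟩).2 ?_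
      rw [hT (f a) ⟨_, hpm⟩ hpl, (hf a ha).2.2.2]
      norm_num
    have hlim : Tendsto (fun b : Fin n → w =>
        toWeakSpace ℝ H (p a + c • ∑ i, e (b i))) (Filter.pi fun _ => cofinite)
        (𝓝 (toWeakSpace ℝ H (p a))) := by
      have hsum := tendsto_finsetSum (Finset.univ : Finset (Fin n)) fun i _ =>
        he.tendsto_toWeakSpace_cofinite.comp (tendsto_eval_pi (fun _ : Fin n => cofinite) i)
      have := (hsum.const_smul c).const_add (toWeakSpace ℝ H (p a))
      simpa [Function.comp_def, e] using this
    obtain ⟨I, hI, s, hs, hsub⟩ := mem_pi.1 (hlim (hU.mem_nhds hpU))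
    refine ⟨⋃ i, (s i)ᶜ, finite_iUnion fun i => hs i, fun _ b hb h => (hmem _).1 ?_⟩
    exact hsub fun i _ => by
      by_contra hbi
      exact hb i (mem_iUnion.2 ⟨i, hbi⟩)
  choose F hFfin hF using hloc
  obtain ⟨a, hao, ha⟩ := exists_free_tuple_of_not_countable (fun x => insert x (F x))
    (fun x => (hFfin x).insert x) (n + 1) hXo
  replace hao : ∀ i, a i ≠ o := hao
  have hainj : Function.Injective a := fun i j hij => by
    by_contra hne
    exact ha i j hne (hij ▸ mem_insert _ _)
  have hy : toWeakSpace ℝ H (t • e o + c • ∑ i, e (a i)) ∈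
      (toWeakSpace ℝ H) '' Metric.closedBall 0 mu := by
    refine ⟨_, ?_, rfl⟩
    rw [mem_closedBall_zero_iff, ← sq_le_sq₀ (norm_nonneg _) (h0.trans h1).le,
      he.norm_smul_add_smul_sum_sq t c hainj hao]
    push_cast
    linarith
  have hlarge : ∀ i, 1 / 2 < T (f (a i)) ⟨_, hy⟩ := by
    intro i
    have := hF (a i) (hao i) (fun j => a (i.succAbove j))
      (fun j hj => ha _ _ (i.succAbove_ne j) (mem_insert_of_mem _ hj))
    have hsplit : p (a i) + c • ∑ j, e (a (i.succAbove j)) = t • e o + c • ∑ j, e (a j) := by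
      rw [Fin.sum_univ_succAbove _ i, smul_add, ← add_assoc]
    simp only [hsplit] at this
    exact this hy
  have hnorm : ‖∑ i, f (a i)‖ ≤ 1 := by
    refine (BoundedContinuousFunction.norm_le zero_le_one).2 fun x => ?_
    rw [BoundedContinuousFunction.sum_apply,
      Real.norm_of_nonneg (Finset.sum_nonneg fun i _ => (hf _ (hao i)).1 x)]
    exact Finset.sum_le_one_of_pairwise_eq_zero _ _ (fun i => (hf _ (hao i)).2.1 x)
      fun i j hij => hdisj _ _ (hao i) (hao j) (hainj.ne hij) x
  have hupper : ∑ i, T (f (a i)) ⟨_, hy⟩ ≤ ‖T‖ :=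
    calc ∑ i, T (f (a i)) ⟨_, hy⟩ = T (∑ i, f (a i)) ⟨_, hy⟩ := by
          rw [map_sum, BoundedContinuousFunction.sum_apply]
      _ ≤ ‖T (∑ i, f (a i))‖ :=
          (Real.le_norm_self _).trans (BoundedContinuousFunction.norm_coe_le_norm _ _)
      _ ≤ ‖T‖ * 1 := T.le_opNorm_of_le hnorm
      _ = ‖T‖ := mul_one _
  have hlower : ((n + 1 : ℕ) : ℝ) * (1 / 2) ≤ ∑ i, T (f (a i)) ⟨_, hy⟩ := by
    simpa using Finset.card_nsmul_le_sum Finset.univ (fun i => T (f (a i)) ⟨_, hy⟩) (1 / 2)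
      fun i _ => (hlarge i).le
  push_cast at hlower
  linarith
end
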